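/- Consider the CLTSP with general processing times, only deadlines (r(a) = 0 for all a ∈ A) and slow clients (0 < v < 1). If the instance admits a feasible solution, then there exists an optimal solution in which the clients are colliding, i.e., for each client a with a = σ_i one has t(a) = max{r(a) + |s(a) − x(a)|/v, c_{i−1}} (each client travels at full speed towards its rendezvous position from its release and is served there as early as the server's previous completion permits). -/

import Mathlib

open scoped BigOperators

/-- An instance of the collaborative line TSP/TRP: a finite set of `n` clients,
a client speed `v > 0`, and for each client a start position `s`, release date
`r ≥ 0`, deadline `d ∈ [0, ∞]` and processing time `tau ≥ 0`. -/
structure CInstance (n : ℕ) where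
  v : ℝ
  s : Fin n → ℝ
  r : Fin n → ℝ
  d : Fin n → EReal
  tau : Fin n → ℝ
  hv : 0 < v
  hr : ∀ a, 0 ≤ r a
  hd : ∀ a, (0 : EReal) ≤ d a
  htau : ∀ a, 0 ≤ tau a

/-- A solution: a serving order `σ` (the `i`-th rendezvous, `i = 0, …, n-1`
in zero-based counting, serves client `σ i`), a rendezvous time `t a` and a
rendezvous position `x a` for every client `a`, and a final time `tEnd` at
which the server is back at the origin. -/
structure CSolution (n : ℕ) where
  σ : Equiv.Perm (Fin n)
  t : Fin n → ℝ
  x : Fin n → ℝ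
  tEnd : ℝ

namespace CLTSP

variable {n : ℕ}

/-- Position `x_i` of the `i`-th server stop, `i = 0, …, n+1`; `x_0 = x_{n+1} = 0`. -/
def pos (sol : CSolution n) (i : ℕ) : ℝ :=
  if h : 1 ≤ i ∧ i ≤ n then sol.x (sol.σ ⟨i - 1, by omega⟩) else 0

/-- Time `t_i` of the `i`-th server stop, `i = 0, …, n+1`; `t_0 = 0`, `t_{n+1} = tEnd`. -/
def time (sol : CSolution n) (i : ℕ) : ℝ :=
  if h : 1 ≤ i ∧ i ≤ n then sol.t (sol.σ ⟨i - 1, by omega⟩)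
  else if i = 0 then 0 else sol.tEnd

/-- Completion time `c_i` of the `i`-th rendezvous: `c_0 = 0`,
`c_i = t_i + τ(σ_i)` for `1 ≤ i ≤ n`, and `c_{n+1} = tEnd`. -/
def comp (I : CInstance n) (sol : CSolution n) (i : ℕ) : ℝ :=
  if h : 1 ≤ i ∧ i ≤ n then
    sol.t (sol.σ ⟨i - 1, by omega⟩) + I.tau (sol.σ ⟨i - 1, by omega⟩)
  else if i = 0 then 0 else sol.tEnd

/-- Feasibility: every rendezvous (including the final return to the origin) is
reachable by the server, every rendezvous is reachable by the corresponding
client, and every client is served within its time window. -/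
def Feasible (I : CInstance n) (sol : CSolution n) : Prop :=
  (∀ i : ℕ, 1 ≤ i → i ≤ n + 1 →
      comp I sol (i - 1) + |pos sol i - pos sol (i - 1)| ≤ time sol i) ∧
  (∀ a, I.r a + |sol.x a - I.s a| / I.v ≤ sol.t a) ∧
  (∀ a, I.r a ≤ sol.t a ∧ (sol.t a : EReal) ≤ I.d a)

/-- The makespan `C_max = c_{n+1}`. -/
def makespan (sol : CSolution n) : ℝ := sol.tEnd

/-- The sum of completion times `C_sum = ∑_{i=1}^n c_i = ∑_a (t a + τ a)`. -/
def csum (I : CInstance n) (sol : CSolution n) : ℝ :=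
  ∑ a : Fin n, (sol.t a + I.tau a)

/-- An optimal CLTSP solution: feasible with minimum makespan. -/
def OptimalTSP (I : CInstance n) (sol : CSolution n) : Prop :=
  Feasible I sol ∧ ∀ sol' : CSolution n, Feasible I sol' → makespan sol ≤ makespan sol'

/-- An optimal CLTRP solution: feasible with minimum sum of completion times. -/
def OptimalTRP (I : CInstance n) (sol : CSolution n) : Prop :=
  Feasible I sol ∧ ∀ sol' : CSolution n, Feasible I sol' → csum I sol ≤ csum I sol'

/-- Order-preserving: for clients `a, a'` both in `L = {a : s a ≤ 0}` or both in
`R = {a : 0 < s a}` with `|s a| < |s a'|` we have `t a < t a'`. -/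
def OrderPreserving (I : CInstance n) (sol : CSolution n) : Prop :=
  ∀ a a' : Fin n,
    ((I.s a ≤ 0 ∧ I.s a' ≤ 0) ∨ (0 < I.s a ∧ 0 < I.s a')) →
    |I.s a| < |I.s a'| → sol.t a < sol.t a'

/-- Wait-free server: `t_i = c_{i-1} + |x_i - x_{i-1}|` for all `1 ≤ i ≤ n+1`. -/
def WaitFree (I : CInstance n) (sol : CSolution n) : Prop :=
  ∀ i : ℕ, 1 ≤ i → i ≤ n + 1 →
    time sol i = comp I sol (i - 1) + |pos sol i - pos sol (i - 1)|

/-- Colliding clients: each client `a = σ_i` satisfies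
`t a = max (r a + |s a - x a| / v) (c_{i-1})`. -/
def Colliding (I : CInstance n) (sol : CSolution n) : Prop :=
  ∀ a : Fin n,
    sol.t a = max (I.r a + |I.s a - sol.x a| / I.v)
      (comp I sol ((sol.σ.symm a : ℕ)))

end CLTSP

namespace CLTSP

/-- `(t, x)` is a collision of a server at position `p` at time `c` with a client starting from `s`
at time `0` with speed `v`, such that after it the server can still join every other rendezvous. -/
structure IsMeeting (v c p s t x : ℝ) : Prop where
  server : c + |x - p| ≤ t
  colliding : t = max (|s - x| / v) c
  le_of_reachable : ∀ t' x', c + |x' - p| ≤ t' → |x' - s| / v ≤ t' → t + |x - x'| ≤ t'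

theorem exists_isMeeting {v c : ℝ} (hv : 0 < v) (hv1 : v < 1) (hc : 0 ≤ c) (p s : ℝ) :
    ∃ t x, IsMeeting v c p s t x := by
  by_cases h : |s - p| ≤ v * c
  · refine ⟨c, p, by simp, ?_, fun t' x' h1 _ => by rwa [abs_sub_comm p x']⟩
    rw [max_eq_right]
    rwa [div_le_iff₀' hv]
  push Not at h
  obtain ⟨δ, hδ⟩ : ∃ δ, δ * (1 + v) = |s - p| - v * c :=
    ⟨(|s - p| - v * c) / (1 + v), by field_simp⟩
  have hδ0 : 0 < δ := by
    by_contra! hneg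
    nlinarith
  have hvc : 0 ≤ v * c := by positivity
  have hvδ : 0 < v * δ := by positivity
  have slow : ∀ y, 0 ≤ y → ∀ t', v * (c + δ) + y ≤ v * t' → c + δ + y ≤ t' := by
    intro y hy t' h'
    by_contra! hlt
    nlinarith
  rcases le_total p s with hps | hps
  · rw [abs_of_nonneg (by linarith)] at hδ h
    refine ⟨c + δ, p + δ, ?_, ?_, fun t' x' h1 h2 => ?_⟩
    · rw [add_sub_cancel_left, abs_of_pos hδ0]
    · rw [abs_of_nonneg (by linarith), max_eq_left]
      · rw [eq_div_iff hv.ne']; linarith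
      · rw [le_div_iff₀ hv]; linarith
    · rw [div_le_iff₀' hv] at h2
      rcases le_total x' (p + δ) with hx | hx
      · rw [abs_of_nonneg (by linarith)]
        exact slow _ (by linarith) _ (by linarith [neg_abs_le (x' - s)])
      · rw [abs_of_nonpos (by linarith)]
        linarith [le_abs_self (x' - p)]
  · rw [abs_of_nonpos (by linarith)] at hδ h
    refine ⟨c + δ, p - δ, ?_, ?_, fun t' x' h1 h2 => ?_⟩
    · rw [sub_sub_cancel_left, abs_neg, abs_of_pos hδ0]
    · rw [abs_of_nonpos (by linarith), max_eq_left]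
      · rw [eq_div_iff hv.ne']; linarith
      · rw [le_div_iff₀ hv]; linarith
    · rw [div_le_iff₀' hv] at h2
      rcases le_total (p - δ) x' with hx | hx
      · rw [abs_of_nonpos (by linarith)]
        exact slow _ (by linarith) _ (by linarith [le_abs_self (x' - s)])
      · rw [abs_of_nonneg (by linarith)]
        linarith [neg_abs_le (x' - p)]

/-- The greedy route: `c i` and `p i` are the time and position of the server after `i` services,
`t i` is the time of the `i`-th meeting, counted from zero. -/
theorem exists_greedy_route {v : ℝ} (hv : 0 < v) (hv1 : v < 1) (s τ : ℕ → ℝ) (hτ : ∀ i, 0 ≤ τ i) :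
    ∃ c t p : ℕ → ℝ, c 0 = 0 ∧ p 0 = 0 ∧
      ∀ i, c (i + 1) = t i + τ i ∧ IsMeeting v (c i) (p i) (s i) (t i) (p (i + 1)) := by
  have H : ∀ c p s : ℝ, ∃ t x, 0 ≤ c → IsMeeting v c p s t x := fun c p s => by
    by_cases hc : 0 ≤ c
    · obtain ⟨t, x, h⟩ := exists_isMeeting hv hv1 hc p s
      exact ⟨t, x, fun _ => h⟩
    · exact ⟨0, 0, fun h => absurd h hc⟩
  choose T X hTX using H
  let q : ℕ → ℝ × ℝ := fun i =>
    Nat.rec (0, 0) (fun i y => (T y.1 y.2 (s i) + τ i, X y.1 y.2 (s i))) i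
  have hq : ∀ i, 0 ≤ (q i).1 := by
    intro i
    induction i with
    | zero => exact le_rfl
    | succ i ih =>
      have h := (hTX _ (q i).2 (s i) ih).server
      have : (q (i + 1)).1 = T (q i).1 (q i).2 (s i) + τ i := rfl
      linarith [hτ i, abs_nonneg (X (q i).1 (q i).2 (s i) - (q i).2)]
  exact ⟨fun i => (q i).1, fun i => T (q i).1 (q i).2 (s i), fun i => (q i).2, rfl, rfl,
    fun i => ⟨rfl, hTX _ _ _ (hq i)⟩⟩

section

variable {n : ℕ} (I : CInstance n) (sol : CSolution n)

@[simp] theorem pos_zero : pos sol 0 = 0 := by simp [pos]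

@[simp] theorem comp_zero : comp I sol 0 = 0 := by simp [comp]

theorem pos_succ {i : ℕ} (h : i < n) : pos sol (i + 1) = sol.x (sol.σ ⟨i, h⟩) := by
  simp [pos, h]

theorem time_succ {i : ℕ} (h : i < n) : time sol (i + 1) = sol.t (sol.σ ⟨i, h⟩) := by
  simp [time, h]

theorem comp_succ {i : ℕ} (h : i < n) :
    comp I sol (i + 1) = sol.t (sol.σ ⟨i, h⟩) + I.tau (sol.σ ⟨i, h⟩) := by
  simp [comp, h]

theorem pos_last : pos sol (n + 1) = 0 := by simp [pos]

theorem time_last : time sol (n + 1) = sol.tEnd := by simp [time]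

/-- For every serving order there is a colliding solution which respects the speeds and is at
least as early as every feasible solution with that order. -/
theorem exists_colliding_dominating (hrel : ∀ a, I.r a = 0) (hslow : I.v < 1)
    (σ : Equiv.Perm (Fin n)) :
    ∃ sol : CSolution n, Colliding I sol ∧
      ∀ sol' : CSolution n, sol'.σ = σ → Feasible I sol' →
        Feasible I sol ∧ sol.tEnd ≤ sol'.tEnd := by
  obtain ⟨c, t, p, hc0, hp0, H⟩ := exists_greedy_route I.hv hslow
    (fun i => if h : i < n then I.s (σ ⟨i, h⟩) else 0)
    (fun i => if h : i < n then I.tau (σ ⟨i, h⟩) else 0)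
    (fun i => by split_ifs; exacts [I.htau _, le_rfl])
  have hmeet : ∀ i (h : i < n),
      IsMeeting I.v (c i) (p i) (I.s (σ ⟨i, h⟩)) (t i) (p (i + 1)) := fun i h => by
    simpa [h] using (H i).2
  have hcsucc : ∀ i (h : i < n), c (i + 1) = t i + I.tau (σ ⟨i, h⟩) := fun i h => by
    simpa [h] using (H i).1
  let sol : CSolution n :=
    ⟨σ, fun a => t (σ.symm a), fun a => p (σ.symm a + 1), c n + |p n|⟩
  have hcomp : ∀ i ≤ n, comp I sol i = c i := by
    rintro (_ | i) hi
    · simp [hc0]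
    · rw [comp_succ I sol hi, hcsucc i hi]
      simp [sol]
  have hpos : ∀ i ≤ n, pos sol i = p i := by
    rintro (_ | i) hi
    · simp [hp0]
    · rw [pos_succ sol hi]
      simp [sol]
  have hcoll : Colliding I sol := by
    intro a
    have h := (hmeet _ (σ.symm a).isLt).colliding
    rw [hcomp _ (σ.symm a).isLt.le, hrel, zero_add]
    simpa using h
  refine ⟨sol, hcoll, ?_⟩
  rintro sol' rfl ⟨hserver, hclient, hwindow⟩
  have hdom : ∀ i (h : i < n), c i + |p i - pos sol' i| ≤ comp I sol' i →
      t i + |p (i + 1) - pos sol' (i + 1)| ≤ sol'.t (sol'.σ ⟨i, h⟩) := by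
    intro i h ih
    have h1 := hserver (i + 1) (by omega) (by omega)
    rw [Nat.add_sub_cancel, time_succ sol' h] at h1
    refine (hmeet i h).le_of_reachable _ _ ?_ ?_
    · linarith [abs_sub_le (pos sol' (i + 1)) (pos sol' i) (p i),
        abs_sub_comm (p i) (pos sol' i)]
    · have h2 := hclient (sol'.σ ⟨i, h⟩)
      rwa [hrel, zero_add, ← pos_succ sol' h] at h2
  have hle : ∀ i ≤ n, c i + |p i - pos sol' i| ≤ comp I sol' i := by
    intro i
    induction i with
    | zero => simp [hc0, hp0]
    | succ i ih =>
      intro hi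
      have h := hdom i hi (ih (by omega))
      rw [comp_succ I sol' hi, hcsucc i hi]
      linarith
  have ht : ∀ a, sol.t a ≤ sol'.t a := by
    intro a
    have hlt := (sol'.σ.symm a).isLt
    have h := hdom _ hlt (hle _ hlt.le)
    rw [Fin.eta, Equiv.apply_symm_apply] at h
    exact (le_add_of_nonneg_right (abs_nonneg _)).trans h
  have hclient' : ∀ a, I.r a + |sol.x a - I.s a| / I.v ≤ sol.t a := fun a => by
    rw [hcoll a, abs_sub_comm]
    exact le_max_left _ _
  refine ⟨⟨fun i hi hin => ?_, hclient', fun a => ⟨?_, ?_⟩⟩, ?_⟩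
  · obtain ⟨i, rfl⟩ := Nat.exists_eq_add_of_le' hi
    rw [Nat.add_sub_cancel, hcomp i (by omega), hpos i (by omega)]
    rcases Nat.lt_or_eq_of_le (Nat.le_of_succ_le_succ hin) with h | rfl
    · rw [hpos _ h, time_succ sol h]
      simpa [sol] using (hmeet i h).server
    · rw [pos_last, time_last]
      simp [sol]
  · exact (le_add_of_nonneg_right (div_nonneg (abs_nonneg _) I.hv.le)).trans (hclient' a)
  · exact (EReal.coe_le_coe_iff.mpr (ht a)).trans (hwindow a).2
  · have h1 := hserver (n + 1) (by omega) le_rfl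
    rw [Nat.add_sub_cancel, pos_last, time_last, zero_sub, abs_neg] at h1
    have h2 := hle n le_rfl
    change c n + |p n| ≤ _
    linarith [abs_sub_abs_le_abs_sub (p n) (pos sol' n)]

end

end CLTSP

open CLTSP in
/-- CLTSP with general processing times, only deadlines and slow
clients: if a feasible solution exists, there exists an optimal solution in
which the clients are colliding. -/
theorem cltsp_genProc_deadlines_slow_exists_colliding_optimal
    {n : ℕ} (I : CInstance n)
    (hrel : ∀ a, I.r a = 0) (hslow : I.v < 1)
    (hfeas : ∃ sol : CSolution n, Feasible I sol) :
    ∃ sol : CSolution n, OptimalTSP I sol ∧ Colliding I sol := by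
  choose G hG using exists_colliding_dominating I hrel hslow
  obtain ⟨sol₀, h₀⟩ := hfeas
  obtain ⟨σ, hσ, hmin⟩ := (Set.toFinite {σ | Feasible I (G σ)}).exists_minimalFor
    (fun σ => (G σ).tEnd) _ ⟨sol₀.σ, ((hG _).2 sol₀ rfl h₀).1⟩
  refine ⟨G σ, ⟨hσ, fun sol h => ?_⟩, (hG σ).1⟩
  obtain ⟨hf, hle⟩ := (hG _).2 sol rfl h
  exact ((le_total _ _).elim id (hmin hf)).trans hle
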